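/- (Closing a projector onto a projector) For all 1 ≤ n ≤ m: (−1)^n · (id^{⊗(m−n)} ⊗ Ca_n) ∘ (t_m ⊗ t_n) ∘ (id^{⊗(m−n)} ⊗ Cu_n) = t_{m−n} as endomorphisms of V^{⊗(m−n)}, where for n = m the identity factors are absent and t₀ := 2 · id_ℂ. -/

import Mathlib

open Matrix

noncomputable section

/-- Sign strings `ε ∈ {+,-}^m`; `true` encodes `+` and `false` encodes `-`. -/
abbrev Sgn (m : ℕ) := Fin m → Bool

/-- Endomorphisms of `V^{⊗m}` (`V = ℂ²`), as matrices indexed by sign strings. -/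
abbrev Op (m : ℕ) := Matrix (Sgn m) (Sgn m) ℂ

/-- Linear maps `V^{⊗m} → V^{⊗n}`, as matrices (rows: target, columns: source). -/
abbrev Mor (m n : ℕ) := Matrix (Sgn n) (Sgn m) ℂ

/-- The basis vector `v_ε` of `V^{⊗m}`. -/
def bv {m : ℕ} (ε : Sgn m) : Sgn m → ℂ := fun δ => if δ = ε then 1 else 0

/-- The coefficient of `cap` on `v_a ⊗ v_b`:
`cap (v₋ ⊗ v₊) = 1`, `cap (v₊ ⊗ v₋) = -1`, `cap (v₊ ⊗ v₊) = cap (v₋ ⊗ v₋) = 0`. -/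
def capc (a b : Bool) : ℂ := if a then (if b then 0 else -1) else (if b then 1 else 0)

/-- The coefficient of `v_a ⊗ v_b` in `cup 1 = v₊ ⊗ v₋ - v₋ ⊗ v₊`. -/
def cupc (a b : Bool) : ℂ := if a then (if b then 0 else 1) else (if b then -1 else 0)

/-- The cap `V ⊗ V → ℂ`. -/
def capM : Mor 2 0 := Matrix.of fun _ ε => capc (ε 0) (ε 1)

/-- The cup `ℂ → V ⊗ V`. -/
def cupM : Mor 0 2 := Matrix.of fun δ _ => cupc (δ 0) (δ 1)

/-- The tensor product of two linear maps. -/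
def tensMor {a b c d : ℕ} (A : Mor a b) (B : Mor c d) : Mor (a + c) (b + d) :=
  Matrix.of fun δ ε =>
    A (fun i => δ (Fin.castAdd d i)) (fun i => ε (Fin.castAdd c i)) *
      B (fun j => δ (Fin.natAdd b j)) (fun j => ε (Fin.natAdd a j))

/-- The swap of the two tensor factors of `V ⊗ V`. -/
def swap2 : Op 2 := Matrix.of fun δ ε => if δ 0 = ε 1 ∧ δ 1 = ε 0 then 1 else 0

/-- `id^{⊗p} ⊗ A ⊗ id^{⊗(m-p-2)}`: the operator `A` on two strands placed at the
(0-based) positions `p`, `p+1` among `m` strands. -/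
def atPos (m p : ℕ) (A : Op 2) : Op m :=
  Matrix.of fun δ ε =>
    if h : p + 2 ≤ m then
      (if ∀ k : Fin m, k.val ≠ p → k.val ≠ p + 1 → δ k = ε k then 1 else 0) *
        A (fun i => δ ⟨p + i.val, Nat.lt_of_lt_of_le (Nat.add_lt_add_left i.isLt p) h⟩)
          (fun i => ε ⟨p + i.val, Nat.lt_of_lt_of_le (Nat.add_lt_add_left i.isLt p) h⟩)
    else 0

/-- Cyclic rotation of sign strings: `(rotIdx δ) k = δ (k+1 mod m)`. -/
def rotIdx {m : ℕ} (δ : Sgn m) : Sgn m := fun k => δ ⟨(k.val + 1) % m, Nat.mod_lt _ k.pos⟩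

/-- The rotation `d_m : V^{⊗m} → V^{⊗m}`, `d_m (v_ε ⊗ w) = i^{ε} (w ⊗ v_ε)`. -/
def dRot : (m : ℕ) → Op m
  | 0 => 1
  | (m + 1) =>
    Matrix.of fun δ' δ =>
      if δ' = rotIdx δ then (if δ 0 then Complex.I else -Complex.I) else 0

/-- The cap-cup generator `u_j` (`j` is 1-based, `1 ≤ j ≤ m-1`);
`u_0 := d_m⁻¹ ∘ u_1 ∘ d_m` is the affine generator. -/
def uFull (m j : ℕ) : Op m :=
  if j = 0 then (dRot m)⁻¹ * atPos m 0 (cupM * capM) * dRot m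
  else atPos m (j - 1) (cupM * capM)

/-- The extremal weight projectors `t_m`, defined by `t₁ = id`,
`t₂ = id + u₁/2 + u₀/2`, and `t_{m+1} = (t_m ⊗ id) ∘ σ_m ∘ (t_m ⊗ id)` for `m ≥ 2`
(with the convention `t₀ = 2·id`). -/
def tP : (m : ℕ) → Op m
  | 0 => (2 : ℂ) • 1
  | 1 => 1
  | 2 => 1 + (2⁻¹ : ℂ) • atPos 2 0 (cupM * capM) +
      (2⁻¹ : ℂ) • ((dRot 2)⁻¹ * atPos 2 0 (cupM * capM) * dRot 2)
  | (m + 3) =>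
    tensMor (tP (m + 2)) (1 : Op 1) * atPos (m + 3) (m + 1) swap2 *
      tensMor (tP (m + 2)) (1 : Op 1)

/-- `n` nested caps `Ca_n : V^{⊗2n} → ℂ`. -/
def CaM (n : ℕ) : Mor (n + n) 0 :=
  Matrix.of fun _ δ =>
    ∏ k : Fin n,
      capc (δ ⟨k.val, Nat.lt_of_lt_of_le k.isLt (Nat.le_add_right n n)⟩)
        (δ ⟨n + n - 1 - k.val,
          Nat.lt_of_le_of_lt (Nat.sub_le _ _)
            (Nat.sub_lt (Nat.lt_of_lt_of_le k.pos (Nat.le_add_right n n)) Nat.one_pos)⟩)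

/-- `n` nested cups `Cu_n : ℂ → V^{⊗2n}`. -/
def CuM (n : ℕ) : Mor 0 (n + n) :=
  Matrix.of fun δ _ =>
    ∏ k : Fin n,
      cupc (δ ⟨k.val, Nat.lt_of_lt_of_le k.isLt (Nat.le_add_right n n)⟩)
        (δ ⟨n + n - 1 - k.val,
          Nat.lt_of_le_of_lt (Nat.sub_le _ _)
            (Nat.sub_lt (Nat.lt_of_lt_of_le k.pos (Nat.le_add_right n n)) Nat.one_pos)⟩)

/-- The canonical identification of sign strings induced by an equality of lengths. -/
def sgnCast {a b : ℕ} (h : a = b) : Sgn a ≃ Sgn b :=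
  Equiv.arrowCongr (finCongr h) (Equiv.refl Bool)

/-- Reindexing of a linear map along equalities of the numbers of strands. -/
def rc {a b c d : ℕ} (h1 : a = b) (h2 : c = d) (A : Mor a c) : Mor b d :=
  Matrix.reindex (sgnCast h2) (sgnCast h1) A

/-- The idempotents `e_{m,n}`:
`e_{1,1} = -u₁/2 - d₂⁻¹ ∘ u₁ ∘ d₂ / 2` and
`e_{m,n} = -(t_m ⊗ t_n) ∘ u_m ∘ (t_m ⊗ t_n)` otherwise. -/
def eP : (m n : ℕ) → Op (m + n)
  | 1, 1 =>
    (-(2⁻¹ : ℂ)) • atPos 2 0 (cupM * capM) +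
      (-(2⁻¹ : ℂ)) • ((dRot 2)⁻¹ * atPos 2 0 (cupM * capM) * dRot 2)
  | m, n =>
    -(tensMor (tP m) (tP n) * atPos (m + n) (m - 1) (cupM * capM) * tensMor (tP m) (tP n))

theorem sum_sgn_two (f : Sgn 2 → ℂ) : ∑ x, f x = ∑ a, ∑ b, f ![a, b] := by
  rw [← Fintype.sum_prod_type' (f := fun a b => f ![a, b])]
  exact Fintype.sum_equiv (finTwoArrowEquiv Bool) _ _ fun x => by
    congr 1
    ext i
    fin_cases i <;> rfl

theorem rotIdx_two (a b : Bool) : rotIdx ![a, b] = ![b, a] := by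
  ext i
  fin_cases i <;> rfl

theorem vec_two_inj (a b c d : Bool) : ![a, b] = ![c, d] ↔ a = c ∧ b = d := by
  simp

theorem dRot_two_apply (a b c d : Bool) :
    dRot 2 ![a, b] ![c, d] =
      if a = d ∧ b = c then (if c then Complex.I else -Complex.I) else 0 := by
  simp only [dRot, Matrix.of_apply, rotIdx_two]
  exact if_congr (vec_two_inj a b d c) rfl rfl

theorem dRot_two_inv : (dRot 2)⁻¹ = (dRot 2)ᴴ := by
  refine Matrix.inv_eq_right_inv ?_
  ext δ ε
  obtain ⟨⟨a, b⟩, rfl⟩ := (finTwoArrowEquiv Bool).symm.surjective δ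
  obtain ⟨⟨c, d⟩, rfl⟩ := (finTwoArrowEquiv Bool).symm.surjective ε
  change _ = (1 : Op 2) ![a, b] ![c, d]
  change (dRot 2 * (dRot 2)ᴴ) ![a, b] ![c, d] = _
  rw [Matrix.mul_apply, sum_sgn_two]
  simp only [Matrix.conjTranspose_apply, dRot_two_apply, Matrix.one_apply, vec_two_inj,
    Fintype.sum_bool]
  cases a <;> cases b <;> cases c <;> cases d <;> simp

theorem atPos_two_zero_apply (a b c d : Bool) :
    atPos 2 0 (cupM * capM) ![a, b] ![c, d] = cupc a b * capc c d := by
  simp [atPos, Matrix.mul_apply, cupM, capM]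

/-- The projector onto the span of the vectors `v_ε` with `ε` constant. -/
def constProj (m : ℕ) : Op m :=
  Matrix.diagonal fun ε => if ∀ i j, ε i = ε j then 1 else 0

theorem tP_two : tP 2 = constProj 2 := by
  ext δ ε
  obtain ⟨⟨a, b⟩, rfl⟩ := (finTwoArrowEquiv Bool).symm.surjective δ
  obtain ⟨⟨c, d⟩, rfl⟩ := (finTwoArrowEquiv Bool).symm.surjective ε
  change tP 2 ![a, b] ![c, d] = constProj 2 ![a, b] ![c, d]
  rw [tP, dRot_two_inv]
  simp only [Matrix.add_apply, Matrix.smul_apply, Matrix.mul_apply (N := dRot 2),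
    Matrix.mul_apply (M := (dRot 2)ᴴ), sum_sgn_two, Matrix.conjTranspose_apply, dRot_two_apply,
    atPos_two_zero_apply, Matrix.one_apply, vec_two_inj, constProj, Matrix.diagonal_apply,
    Fintype.sum_bool, Fin.forall_fin_two]
  cases a <;> cases b <;> cases c <;> cases d <;> simp [cupc, capc] <;> norm_num

theorem tensMor_diagonal {a b : ℕ} (f : Sgn a → ℂ) (g : Sgn b → ℂ) :
    tensMor (Matrix.diagonal f) (Matrix.diagonal g) =
      Matrix.diagonal fun ε =>
        f (fun i => ε (Fin.castAdd b i)) * g (fun j => ε (Fin.natAdd a j)) := by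
  ext δ ε
  by_cases h : δ = ε
  · subst h
    simp [tensMor]
  · rw [Matrix.diagonal_apply_ne _ h]
    simp only [tensMor, Matrix.of_apply, Matrix.diagonal_apply]
    split_ifs with h₁ h₂
    · refine absurd (funext fun i => ?_) h
      refine Fin.addCases (fun i => congrFun h₁ i) (fun i => congrFun h₂ i) i
    all_goals simp

theorem constProj_succ (m : ℕ) :
    tensMor (constProj (m + 2)) (1 : Op 1) * atPos (m + 3) (m + 1) swap2 *
      tensMor (constProj (m + 2)) (1 : Op 1) = constProj (m + 3) := by
  rw [constProj, constProj, ← Matrix.diagonal_one, tensMor_diagonal]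
  ext δ ε
  rw [Matrix.mul_diagonal, Matrix.diagonal_mul, Matrix.diagonal_apply]
  simp only [atPos, swap2, Matrix.of_apply, mul_one, le_refl, dite_true]
  by_cases hδ : ∀ i j : Fin (m + 2), δ (Fin.castAdd 1 i) = δ (Fin.castAdd 1 j)
  · by_cases hε : ∀ i j : Fin (m + 2), ε (Fin.castAdd 1 i) = ε (Fin.castAdd 1 j)
    · rw [if_pos hδ, if_pos hε]
      have hδ' : ∀ k (h : k < m + 2), δ ⟨k, by omega⟩ = δ 0 := fun k h => hδ ⟨k, h⟩ 0
      have hε' : ∀ k (h : k < m + 2), ε ⟨k, by omega⟩ = ε 0 := fun k h => hε ⟨k, h⟩ 0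
      have const : ∀ γ : Sgn (m + 3), (∀ k (h : k < m + 2), γ ⟨k, by omega⟩ = γ 0) →
          γ ⟨m + 2, by omega⟩ = γ 0 → ∀ k, γ k = γ 0 := by
        intro γ h h' k
        rcases Nat.lt_succ_iff_lt_or_eq.1 k.2 with hk | hk
        · exact h k hk
        · rw [← h']
          exact congrArg γ (Fin.ext hk)
      by_cases hc : δ = ε ∧ ∀ i j, ε i = ε j
      · obtain ⟨rfl, hc⟩ := hc
        have hc' : ∀ i j : Fin (m + 3), δ i = δ j := hc
        rw [if_pos rfl, if_pos hc']
        simp [hc' ⟨m + 1, by omega⟩ ⟨m + 1 + 1, by omega⟩]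
      · have hr : (if δ = ε then (if ∀ i j, δ i = δ j then (1 : ℂ) else 0) else 0) = 0 := by
          split_ifs with h₁ h₂
          · exact absurd ⟨h₁, h₁ ▸ h₂⟩ hc
          all_goals rfl
        rw [hr]
        simp only [one_mul, mul_one]
        split_ifs with h₁ h₂
        · exfalso
          obtain ⟨h₂, h₃⟩ := h₂
          have h₀ : δ 0 = ε 0 := h₁ 0 (by simp) (by simp)
          have hεl : ε ⟨m + 2, by omega⟩ = ε 0 :=
            (h₂.symm.trans (hδ' (m + 1) (by omega))).trans h₀
          have hδl : δ ⟨m + 2, by omega⟩ = δ 0 :=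
            (h₃.trans (hε' (m + 1) (by omega))).trans h₀.symm
          have cε := const ε hε' hεl
          have cδ := const δ hδ' hδl
          exact hc ⟨funext fun k => by rw [cε, cδ, h₀], fun i j => by rw [cε, cε j]⟩
        all_goals simp
    · rw [if_neg hε, mul_zero]
      split_ifs with h₁ h₂
      · subst h₁
        exact absurd hδ hε
      all_goals rfl
  · rw [if_neg hδ, zero_mul, zero_mul]
    split_ifs with h₁ h₂
    · exact absurd (fun i j => h₂ _ _) hδ
    all_goals rfl

theorem tP_succ (m : ℕ) : tP (m + 1) = constProj (m + 1) := by
  induction m with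
  | zero =>
    simp [tP, constProj]
  | succ m ih =>
    cases m with
    | zero => exact tP_two
    | succ m => rw [tP, ih, constProj_succ]

theorem rc_diagonal {a b : ℕ} (h h' : a = b) (f : Sgn a → ℂ) :
    (rc h h' (Matrix.diagonal f) : Op b) =
      Matrix.diagonal fun ε => f fun i => ε (Fin.cast h i) := by
  subst h
  rfl

/-- Partially closing a diagonal operator with caps and cups leaves a diagonal operator. -/
theorem tensMor_one_mul_diagonal_mul {a b : ℕ} (A : Mor b 0) (B : Mor 0 b)
    (f : Sgn (a + b) → ℂ) :
    (tensMor (1 : Op a) A * Matrix.diagonal f * tensMor (1 : Op a) B : Op a) =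
      Matrix.diagonal fun ε =>
        ∑ z : Sgn b, f (Fin.append ε z) * (A Fin.elim0 z * B z Fin.elim0) := by
  refine Matrix.ext fun (δ ε : Sgn a) => ?_
  rw [Matrix.mul_apply]
  simp only [Matrix.mul_diagonal]
  rw [← (Fin.appendEquiv a b).sum_comp, Fintype.sum_prod_type]
  have key (y : Sgn a) (z : Sgn b) :
      (tensMor (1 : Op a) A : Mor (a + b) a) δ (Fin.append y z) * f (Fin.append y z) *
        (tensMor (1 : Op a) B : Mor a (a + b)) (Fin.append y z) ε =
      if δ = y then
        (if y = ε then f (Fin.append y z) * (A Fin.elim0 z * B z Fin.elim0) else 0) else 0 := by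
    have hl : (fun i => Fin.append y z (Fin.castAdd b i)) = y := by simp
    have hr : (fun i => Fin.append y z (Fin.natAdd a i)) = z := by simp
    have h0 (g : Fin 0 → Bool) : g = Fin.elim0 := Subsingleton.elim _ _
    change (1 : Op a) δ _ * A _ _ * _ * ((1 : Op a) _ ε * B _ _) = _
    rw [hl, hr, h0 (fun _ => _), h0 (fun _ => _), Matrix.one_apply, Matrix.one_apply]
    split_ifs <;> ring
  change ∑ y : Sgn a, ∑ z : Sgn b, _ = _
  refine (Finset.sum_congr rfl fun y _ => Finset.sum_congr rfl fun z _ => key y z).trans ?_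
  by_cases h : δ = ε
  · subst h
    rw [Matrix.diagonal_apply_eq, Finset.sum_eq_single δ]
    · simp
    · intro y _ hy
      simp [hy.symm]
    · simp
  · rw [Matrix.diagonal_apply_ne _ h]
    refine Finset.sum_eq_zero fun y _ => Finset.sum_eq_zero fun z _ => ?_
    split_ifs with h₁ h₂
    · exact absurd (h₁.trans h₂) h
    all_goals rfl

theorem capc_mul_cupc (a b : Bool) : capc a b * cupc a b = if b = !a then -1 else 0 := by
  cases a <;> cases b <;> simp [capc, cupc]

theorem CaM_mul_CuM (n : ℕ) (z : Sgn (n + n)) :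
    CaM n Fin.elim0 z * CuM n z Fin.elim0 =
      if ∀ k : Fin n, z ⟨n + n - 1 - k, by omega⟩ = !z ⟨k, by omega⟩ then (-1) ^ n else 0 := by
  simp only [CaM, CuM, Matrix.of_apply, ← Finset.prod_mul_distrib, capc_mul_cupc]
  split_ifs with h
  · simp [h]
  · push Not at h
    obtain ⟨k, hk⟩ := h
    exact Finset.prod_eq_zero (Finset.mem_univ k) (if_neg hk)

/-- The sign string with `n` signs `c` followed by `n` opposite signs. -/
def splitSgn (n : ℕ) (c : Bool) : Sgn (n + n) := Fin.append (fun _ => c) fun _ => !c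

theorem CaM_mul_CuM_splitSgn (n : ℕ) (c : Bool) :
    CaM n Fin.elim0 (splitSgn n c) * CuM n (splitSgn n c) Fin.elim0 = (-1) ^ n := by
  rw [CaM_mul_CuM, if_pos]
  intro k
  have h₁ : (⟨n + n - 1 - k, by omega⟩ : Fin (n + n)) =
      Fin.natAdd n ⟨n - 1 - k, by omega⟩ := Fin.ext (by simp; omega)
  have h₂ : (⟨k, by omega⟩ : Fin (n + n)) = Fin.castAdd n k := rfl
  rw [h₁, h₂, splitSgn, Fin.append_left, Fin.append_right]

theorem sum_ite_forall_eq (a : ℕ) (ε : Sgn a) :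
    ∑ c : Bool, (if ∀ i, ε i = c then (1 : ℂ) else 0) = tP a ε ε := by
  cases a with
  | zero => simp [tP]
  | succ a =>
    rw [tP_succ, constProj, Matrix.diagonal_apply_eq, Finset.sum_eq_single (ε 0)]
    · congr 1
      exact propext ⟨fun h i j => by rw [h i, h j], fun h i => h i 0⟩
    · exact fun c _ hc => if_neg fun h => hc (h 0).symm
    · simp

theorem tP_isDiag (a : ℕ) : (tP a).IsDiag := by
  cases a with
  | zero => exact fun i j h => absurd (Subsingleton.elim i j) h
  | succ a =>
    rw [tP_succ]
    exact Matrix.isDiag_diagonal _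

/-- Closing a projector onto a projector: for `1 ≤ n ≤ m`
(here `m = a + n`), `(-1)^n (id^{⊗(m-n)} ⊗ Ca_n) ∘ (t_m ⊗ t_n) ∘ (id^{⊗(m-n)} ⊗ Cu_n)
= t_{m-n}`, with `t₀ = 2·id_ℂ`. -/
theorem closing_projector (a n : ℕ) (hn : 1 ≤ n) :
    (-1 : ℂ) ^ n •
      (tensMor (1 : Op a) (CaM n) *
        (rc (by omega) (by omega) (tensMor (tP (a + n)) (tP n)) : Op (a + (n + n))) *
        tensMor (1 : Op a) (CuM n)) = tP a := by
  obtain ⟨n, rfl⟩ : ∃ k, n = k + 1 := ⟨n - 1, by omega⟩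
  have hT : tP (a + (n + 1)) = constProj (a + (n + 1)) := tP_succ (a + n)
  rw [hT, tP_succ, constProj, constProj, tensMor_diagonal, rc_diagonal,
    tensMor_one_mul_diagonal_mul, ← (tP_isDiag a).diagonal_diag, ← Matrix.diagonal_smul]
  congr 1
  ext ε
  rw [Matrix.diag_apply, ← sum_ite_forall_eq, Pi.smul_apply, smul_eq_mul]
  have hl (z : Sgn (n + 1 + (n + 1))) :
      (fun i : Fin (a + (n + 1)) => Fin.append ε z (Fin.cast (by omega)
        (Fin.castAdd (n + 1) i))) = Fin.append ε fun i => z (Fin.castAdd (n + 1) i) := by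
    ext i
    refine Fin.addCases (fun i => ?_) (fun i => ?_) i
    · rw [Fin.append_left]
      exact Fin.append_left ε z i
    · rw [Fin.append_right]
      exact Fin.append_right ε z (Fin.castAdd (n + 1) i)
  have hr (z : Sgn (n + 1 + (n + 1))) :
      (fun i : Fin (n + 1) => Fin.append ε z (Fin.cast (by omega)
        (Fin.natAdd (a + (n + 1)) i))) = fun i => z (Fin.natAdd (n + 1) i) := by
    ext i
    rw [← Fin.append_right ε z]
    congr 1
    ext
    simp only [Fin.val_cast, Fin.val_natAdd]
    omega
  have hinj : Function.Injective (splitSgn (n + 1)) := fun c d h => by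
    simpa [splitSgn] using congrFun h (Fin.castAdd (n + 1) 0)
  rw [← Fintype.sum_of_injective (splitSgn (n + 1)) hinj
    (fun c => (-1 : ℂ) ^ (n + 1) * if ∀ i, ε i = c then 1 else 0)]
  · rw [← Finset.mul_sum, ← mul_assoc, ← mul_pow]
    simp
  · intro z hz
    rw [hl, hr, CaM_mul_CuM]
    split_ifs with h₁ h₂ h₃
    · refine absurd ⟨z 0, funext fun i => ?_⟩ hz
      have h₁' (i : Fin (n + 1)) : z (Fin.castAdd (n + 1) i) = z 0 := by
        have := h₁ (Fin.natAdd a i) (Fin.natAdd a 0)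
        rwa [Fin.append_right, Fin.append_right] at this
      refine Fin.addCases (fun i => ?_) (fun i => ?_) i
      · rw [splitSgn, Fin.append_left, h₁']
      · rw [splitSgn, Fin.append_right]
        refine Eq.trans ?_ (h₂ (Fin.last n) i)
        refine (h₃ 0).symm.trans (congrArg z (Fin.ext ?_))
        simp
    all_goals simp
  · intro c
    rw [hl, hr, CaM_mul_CuM_splitSgn]
    simp only [splitSgn, Fin.append_left, Fin.append_right, implies_true, if_true, mul_one]
    rw [mul_comm]
    congr 2
    refine propext ⟨fun h i j => ?_, fun h i => ?_⟩
    · have (k : Fin (a + (n + 1))) : Fin.append ε (fun _ => c) k = c := by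
        refine Fin.addCases (fun k => ?_) (fun k => ?_) k
        · rw [Fin.append_left, h]
        · rw [Fin.append_right]
      rw [this, this]
    · have := h (Fin.castAdd (n + 1) i) (Fin.natAdd a 0)
      rwa [Fin.append_left, Fin.append_right] at this
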